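/- For every u₀ ∈ ℝ there exist δ > 0 and a unique twice continuously differentiable function u : [0,δ) → ℝ with u(0) = u₀ and u'(0) = 0 satisfying, for all θ ∈ (0,δ), the equation u''(θ) + (cos θ/sin θ) · u'(θ) · (1 + u'(θ)²)/(1 − 3u'(θ)²) = (1 + u'(θ)²)(u'(θ)² − 1)/(1 − 3u'(θ)²). Moreover u''(0) = −1/2, u is strictly concave on [0,δ) (u'' < 0), and u has the local expansion u(θ) = u₀ − θ²/4 + O(θ⁴) as θ → 0⁺. -/

import Mathlib

open Real Filter Set Asymptotics

/-- `IsRadialSol δ u₀ u u' u''` says that `u` is a twice continuously differentiable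
solution on `[0,δ)` (with first and second derivatives `u'`, `u''` in the sense of
derivatives within `[0,δ)`, the second one continuous) of the rotationally symmetric
Euler–Lagrange equation of the incompressible source flow model, with `u(0) = u₀` and
`u'(0) = 0` (smoothness at the pole). -/
def IsRadialSol (δ u₀ : ℝ) (u u' u'' : ℝ → ℝ) : Prop :=
  (∀ θ ∈ Set.Ico 0 δ, HasDerivWithinAt u (u' θ) (Set.Ico 0 δ) θ) ∧
  (∀ θ ∈ Set.Ico 0 δ, HasDerivWithinAt u' (u'' θ) (Set.Ico 0 δ) θ) ∧
  ContinuousOn u'' (Set.Ico 0 δ) ∧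
  u 0 = u₀ ∧ u' 0 = 0 ∧
  (∀ θ ∈ Set.Ico 0 δ, 1 - 3 * u' θ ^ 2 ≠ 0) ∧
  ∀ θ ∈ Set.Ioo 0 δ,
    u'' θ + (Real.cos θ / Real.sin θ) * u' θ * ((1 + u' θ ^ 2) / (1 - 3 * u' θ ^ 2)) =
      (1 + u' θ ^ 2) * (u' θ ^ 2 - 1) / (1 - 3 * u' θ ^ 2)

/-- The momentum `p / (1 + p²)²` conjugate to the slope `p`. -/
noncomputable def momentum (p : ℝ) : ℝ := p / (1 + p ^ 2) ^ 2

/-- The right-hand side `(p² - 1) / (1 + p²)²` of the equation in divergence form. -/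
noncomputable def forcing (p : ℝ) : ℝ := (p ^ 2 - 1) / (1 + p ^ 2) ^ 2

lemma hasDerivAt_momentum (p : ℝ) :
    HasDerivAt momentum ((1 - 3 * p ^ 2) / (1 + p ^ 2) ^ 3) p := by
  have h1 : (1 + p ^ 2) ≠ 0 := by positivity
  have h : HasDerivAt (fun x : ℝ => (1 + x ^ 2) ^ 2) (2 * (1 + p ^ 2) * (2 * p)) p :=
    (((hasDerivAt_pow 2 p).const_add 1).fun_pow 2).congr_deriv (by norm_num)
  refine ((hasDerivAt_id' p).fun_div h (by positivity)).congr_deriv ?_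
  field_simp
  ring

lemma hasDerivAt_forcing (p : ℝ) :
    HasDerivAt forcing ((6 * p - 2 * p ^ 3) / (1 + p ^ 2) ^ 3) p := by
  have h1 : (1 + p ^ 2) ≠ 0 := by positivity
  have h : HasDerivAt (fun x : ℝ => (1 + x ^ 2) ^ 2) (2 * (1 + p ^ 2) * (2 * p)) p :=
    (((hasDerivAt_pow 2 p).const_add 1).fun_pow 2).congr_deriv (by norm_num)
  have h' : HasDerivAt (fun x : ℝ => x ^ 2 - 1) (2 * p) p :=
    ((hasDerivAt_pow 2 p).sub_const 1).congr_deriv (by norm_num)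
  refine (h'.fun_div h (by positivity)).congr_deriv ?_
  field_simp
  ring

lemma continuous_momentum : Continuous momentum :=
  continuous_iff_continuousAt.2 fun p => (hasDerivAt_momentum p).continuousAt

@[simp] lemma momentum_zero : momentum 0 = 0 := by simp [momentum]

lemma abs_forcing_le_one (p : ℝ) : |forcing p| ≤ 1 := by
  rw [forcing, abs_le]
  constructor
  · rw [le_div_iff₀ (by positivity)]
    nlinarith [sq_nonneg p, sq_nonneg (p ^ 2)]
  · rw [div_le_iff₀ (by positivity)]
    nlinarith [sq_nonneg p, sq_nonneg (p ^ 2)]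

lemma abs_forcing_add_one_le (p : ℝ) : |forcing p + 1| ≤ 3 * p ^ 2 := by
  have h : forcing p + 1 = (3 * p ^ 2 + p ^ 4) / (1 + p ^ 2) ^ 2 := by
    rw [forcing]
    field_simp
    ring
  rw [h, abs_of_nonneg (by positivity), div_le_iff₀ (by positivity)]
  nlinarith [sq_nonneg p, sq_nonneg (p ^ 2), mul_nonneg (sq_nonneg p) (sq_nonneg (p ^ 2))]

lemma abs_forcing_sub_le (a b : ℝ) : |forcing a - forcing b| ≤ 6 * |a - b| := by
  refine Convex.norm_image_sub_le_of_norm_hasDerivWithin_le (s := Set.univ)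
    (fun x _ => (hasDerivAt_forcing x).hasDerivWithinAt) (fun x _ => ?_) convex_univ
    (Set.mem_univ b) (Set.mem_univ a)
  rw [Real.norm_eq_abs, abs_div, abs_of_nonneg (show 0 ≤ (1 + x ^ 2) ^ 3 by positivity),
    div_le_iff₀ (by positivity), abs_le]
  have h2 := sq_nonneg (x ^ 2)
  have h3 : 0 ≤ x ^ 2 * x ^ 4 := by positivity
  have h4 := sq_nonneg (x * (x + 1))
  have h5 := sq_nonneg (x * (x - 1))
  constructor <;> nlinarith [sq_nonneg (x - 1), sq_nonneg (x + 1), sq_nonneg x]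

/-- On a slope interval bounded away from the degenerate values `±1/√3`, the momentum expands
distances by at least a fixed positive factor. -/
lemma exists_pos_mul_abs_sub_le_abs_momentum_sub {m : ℝ} (hm : 3 * m ^ 2 < 1) :
    ∃ c > 0, ∀ a ∈ Set.Icc (-m) m, ∀ b ∈ Set.Icc (-m) m,
      c * |a - b| ≤ |momentum a - momentum b| := by
  have hc : 0 < (1 - 3 * m ^ 2) / (1 + m ^ 2) ^ 3 := by
    have : 0 < 1 - 3 * m ^ 2 := by linarith
    positivity
  refine ⟨_, hc, ?_⟩
  have key : ∀ a ∈ Set.Icc (-m) m, ∀ b ∈ Set.Icc (-m) m, a ≤ b →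
      (1 - 3 * m ^ 2) / (1 + m ^ 2) ^ 3 * (b - a) ≤ momentum b - momentum a := by
    refine (convex_Icc _ _).mul_sub_le_image_sub_of_le_deriv continuous_momentum.continuousOn
      (fun x _ => (hasDerivAt_momentum x).differentiableAt.differentiableWithinAt) fun x hx => ?_
    rw [(hasDerivAt_momentum x).deriv]
    have hx' := interior_subset hx
    have hxm : x ^ 2 ≤ m ^ 2 := sq_le_sq' hx'.1 hx'.2
    have : 0 ≤ 1 - 3 * x ^ 2 := by linarith
    gcongr
  intro a ha b hb
  rcases le_total a b with h | h
  · rw [abs_sub_comm a, abs_sub_comm (momentum a), abs_of_nonneg (sub_nonneg.2 h)]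
    exact (key a ha b hb h).trans (le_abs_self _)
  · rw [abs_of_nonneg (sub_nonneg.2 h)]
    exact (key b hb a ha h).trans (le_abs_self _)

/-- A globally Lipschitz function inverting the momentum near zero. -/
lemma exists_lipschitz_inverse_momentum :
    ∃ (P : ℝ → ℝ) (K : NNReal), LipschitzWith K P ∧ (∀ y, P y ∈ Set.Icc (-(1 / 2)) (1 / 2)) ∧
      ∀ y ∈ Set.Icc (-(8 / 25)) (8 / 25), momentum (P y) = y := by
  obtain ⟨c, hc, hexp⟩ :=
    exists_pos_mul_abs_sub_le_abs_momentum_sub (m := 1 / 2) (by norm_num)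
  have hsurj : ∀ y ∈ Set.Icc (-(8 / 25) : ℝ) (8 / 25),
      ∃ p ∈ Set.Icc (-(1 / 2) : ℝ) (1 / 2), momentum p = y := by
    intro y hy
    have h := intermediate_value_Icc (show (-(1 / 2) : ℝ) ≤ 1 / 2 by norm_num)
      continuous_momentum.continuousOn
    have e1 : momentum (-(1 / 2)) = -(8 / 25) := by norm_num [momentum]
    have e2 : momentum (1 / 2) = 8 / 25 := by norm_num [momentum]
    rw [e1, e2] at h
    exact h hy
  choose! P hP hPe using hsurj
  have hle : (-(8 / 25) : ℝ) ≤ 8 / 25 := by norm_num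
  refine ⟨fun y => P (Set.projIcc _ _ hle y), Real.toNNReal c⁻¹, ?_,
    fun y => hP _ (Set.projIcc _ _ hle y).2, fun y hy => ?_⟩
  · refine LipschitzWith.of_dist_le_mul fun x y => ?_
    have h1 := hexp _ (hP _ (Set.projIcc _ _ hle x).2) _ (hP _ (Set.projIcc _ _ hle y).2)
    rw [hPe _ (Set.projIcc _ _ hle x).2, hPe _ (Set.projIcc _ _ hle y).2] at h1
    have h2 := (LipschitzWith.projIcc hle).dist_le_mul x y
    rw [Subtype.dist_eq, Real.dist_eq, NNReal.coe_one, one_mul] at h2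
    rw [Real.dist_eq, Real.coe_toNNReal _ (by positivity), inv_mul_eq_div, le_div_iff₀' hc]
    exact h1.trans h2
  · simp only [Set.projIcc_of_mem hle hy]
    exact hPe y hy

lemma hasDerivWithinAt_Ici_of_Icc {f : ℝ → ℝ} {f' b x : ℝ}
    (h : HasDerivWithinAt f f' (Set.Icc 0 b) x) (hx : x ∈ Set.Ico 0 b) :
    HasDerivWithinAt f f' (Set.Ici x) x :=
  h.mono_of_mem_nhdsWithin (mem_of_superset (Icc_mem_nhdsGE hx.2) (Set.Icc_subset_Icc_left hx.1))

lemma exists_flux {P : ℝ → ℝ} {K : NNReal} (hP : LipschitzWith K P) :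
    ∃ Q : ℝ → ℝ, Q 0 = 0 ∧ ∀ t ∈ Set.Icc (0 : ℝ) (1 / 4),
      HasDerivWithinAt Q (Real.sin t * forcing (P (Q t / Real.sin t))) (Set.Icc 0 (1 / 4)) t := by
  have hpl : IsPicardLindelof (fun t y => Real.sin t * forcing (P (y / Real.sin t)))
      (tmin := 0) (tmax := 1 / 4) ⟨0, by norm_num⟩ (0 : ℝ) 1 0 1 (6 * K) := by
    refine ⟨fun t _ => LipschitzWith.lipschitzOnWith (LipschitzWith.of_dist_le_mul fun x y => ?_),
      fun y _ t ht => ContinuousAt.continuousWithinAt ?_, fun t _ y _ => ?_, ?_⟩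
    · have h1 := abs_forcing_sub_le (P (x / Real.sin t)) (P (y / Real.sin t))
      have h2 := hP.dist_le_mul (x / Real.sin t) (y / Real.sin t)
      rw [Real.dist_eq, Real.dist_eq, ← sub_div, abs_div] at h2
      rw [Real.dist_eq, Real.dist_eq, ← mul_sub, abs_mul]
      push_cast
      calc |Real.sin t| * |forcing (P (x / Real.sin t)) - forcing (P (y / Real.sin t))|
          ≤ |Real.sin t| * (6 * (K * (|x - y| / |Real.sin t|))) := by
            gcongr
            exact h1.trans (by gcongr)
        _ = 6 * K * (|Real.sin t| * |x - y| / |Real.sin t|) := by ring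
        _ ≤ 6 * K * |x - y| := by
            gcongr
            rcases (abs_nonneg (Real.sin t)).eq_or_lt' with h | h
            · simp [h]
            · rw [mul_div_cancel_left₀ _ h.ne']
    · rcases ht.1.eq_or_lt' with rfl | h
      · have h0 : Tendsto (fun t => |Real.sin t|) (nhds 0) (nhds 0) := by
          have : Continuous fun t => |Real.sin t| := by fun_prop
          simpa using this.tendsto 0
        have : Tendsto (fun t => Real.sin t * forcing (P (y / Real.sin t))) (nhds 0) (nhds 0) :=
          squeeze_zero_norm (fun t => by
            rw [norm_mul, Real.norm_eq_abs, Real.norm_eq_abs]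
            exact mul_le_of_le_one_right (abs_nonneg _) (abs_forcing_le_one _)) h0
        simpa [ContinuousAt] using this
      · have hs : Real.sin t ≠ 0 :=
          (Real.sin_pos_of_pos_of_lt_pi h (by linarith [ht.2, Real.pi_gt_three])).ne'
        refine Real.continuous_sin.continuousAt.mul ?_
        refine ContinuousAt.comp (hasDerivAt_forcing _).continuousAt ?_
        exact hP.continuous.continuousAt.comp
          (continuousAt_const.div Real.continuous_sin.continuousAt hs)
    · rw [norm_mul, Real.norm_eq_abs, Real.norm_eq_abs, NNReal.coe_one]
      exact mul_le_one₀ (Real.abs_sin_le_one _) (abs_nonneg _) (abs_forcing_le_one _)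
    · norm_num
  exact hpl.exists_eq_forall_mem_Icc_hasDerivWithinAt₀

lemma three_quarters_mul_le_sin {t : ℝ} (ht : t ∈ Set.Icc (0 : ℝ) (1 / 4)) :
    3 / 4 * t ≤ Real.sin t := by
  rcases ht.1.eq_or_lt' with rfl | h
  · simp
  · have h1 := Real.sin_gt_sub_cube h
    have h2 : t ^ 3 ≤ t * (1 / 4) ^ 2 := by
      rw [show t ^ 3 = t * t ^ 2 by ring]
      have := ht.2
      gcongr
    linarith

lemma abs_flux_le {Q p : ℝ → ℝ} (hQ0 : Q 0 = 0)
    (hQ : ∀ t ∈ Set.Icc (0 : ℝ) (1 / 4),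
      HasDerivWithinAt Q (Real.sin t * forcing (p t)) (Set.Icc 0 (1 / 4)) t) :
    ∀ t ∈ Set.Icc (0 : ℝ) (1 / 4), |Q t| ≤ t ^ 2 / 2 := by
  refine image_norm_le_of_norm_deriv_right_le_deriv_boundary
    (fun t ht => (hQ t ht).continuousWithinAt)
    (fun t ht => hasDerivWithinAt_Ici_of_Icc (hQ t (Set.Ico_subset_Icc_self ht)) ht)
    (B := fun t => t ^ 2 / 2) (B' := fun t => t) (by simp [hQ0])
    (fun t => ((hasDerivAt_pow 2 t).div_const 2).congr_deriv (by norm_num)) fun t ht => ?_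
  have hs : 0 ≤ Real.sin t := by
    linarith [three_quarters_mul_le_sin (Set.Ico_subset_Icc_self ht), ht.1]
  rw [norm_mul, Real.norm_eq_abs, Real.norm_eq_abs, abs_of_nonneg hs]
  exact (mul_le_of_le_one_right hs (abs_forcing_le_one _)).trans (Real.sin_le ht.1)

lemma abs_flux_add_one_sub_cos_le {Q p : ℝ → ℝ} (hQ0 : Q 0 = 0)
    (hQ : ∀ t ∈ Set.Icc (0 : ℝ) (1 / 4),
      HasDerivWithinAt Q (Real.sin t * forcing (p t)) (Set.Icc 0 (1 / 4)) t)
    (hp : ∀ t ∈ Set.Icc (0 : ℝ) (1 / 4), |p t| ≤ 2 * t) :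
    ∀ t ∈ Set.Icc (0 : ℝ) (1 / 4), |Q t + (1 - Real.cos t)| ≤ 3 * t ^ 4 := by
  have hd : ∀ t ∈ Set.Icc (0 : ℝ) (1 / 4), HasDerivWithinAt (fun t => Q t + (1 - Real.cos t))
      (Real.sin t * (forcing (p t) + 1)) (Set.Icc 0 (1 / 4)) t := fun t ht =>
    ((hQ t ht).fun_add ((Real.hasDerivAt_cos t).const_sub 1).hasDerivWithinAt).congr_deriv
      (by ring)
  refine image_norm_le_of_norm_deriv_right_le_deriv_boundary
    (fun t ht => (hd t ht).continuousWithinAt)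
    (fun t ht => hasDerivWithinAt_Ici_of_Icc (hd t (Set.Ico_subset_Icc_self ht)) ht)
    (B := fun t => 3 * t ^ 4) (B' := fun t => t * (12 * t ^ 2)) (by simp [hQ0])
    (fun t => ((hasDerivAt_pow 4 t).const_mul 3).congr_deriv (by norm_num; ring)) fun t ht => ?_
  have ht' := Set.Ico_subset_Icc_self ht
  have hs : 0 ≤ Real.sin t := by linarith [three_quarters_mul_le_sin ht', ht.1]
  rw [norm_mul, Real.norm_eq_abs, Real.norm_eq_abs, abs_of_nonneg hs]
  refine mul_le_mul (Real.sin_le ht.1) ?_ (abs_nonneg _) ht.1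
  have h1 := sq_le_sq' (abs_le.1 (hp t ht')).1 (abs_le.1 (hp t ht')).2
  linarith [abs_forcing_add_one_le (p t)]

lemma momentum_sub_self (p : ℝ) : p - momentum p = momentum p * (2 * p ^ 2 + p ^ 4) := by
  rw [momentum]
  field_simp
  ring

/-- The value of `u''` forced by the equation at angle `t` and slope `p`. -/
noncomputable def slopeRate (t p : ℝ) : ℝ :=
  ((1 + p ^ 2) * (p ^ 2 - 1) - Real.cos t / Real.sin t * (p * (1 + p ^ 2))) / (1 - 3 * p ^ 2)

lemma exists_slope : ∃ p : ℝ → ℝ, p 0 = 0 ∧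
    (∀ t ∈ Set.Icc (0 : ℝ) (1 / 4), |p t| ≤ 1 / 2) ∧
    (∀ t ∈ Set.Icc (0 : ℝ) (1 / 4), |p t + t / 2| ≤ 14 * t ^ 3) ∧
    (∀ t ∈ Set.Ioo (0 : ℝ) (1 / 4), HasDerivAt p (slopeRate t (p t)) t) := by
  obtain ⟨P, K, hP, hPmem, hPinv⟩ := exists_lipschitz_inverse_momentum
  obtain ⟨Q, hQ0, hQ⟩ := exists_flux hP
  have hQle := abs_flux_le hQ0 hQ
  have hqle : ∀ t ∈ Set.Icc (0 : ℝ) (1 / 4), |Q t / Real.sin t| ≤ 2 / 3 * t := by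
    intro t ht
    rcases ht.1.eq_or_lt' with rfl | h
    · simp
    have hs := three_quarters_mul_le_sin ht
    have hs0 : 0 < Real.sin t := by linarith
    rw [abs_div, abs_of_pos hs0, div_le_iff₀ hs0]
    nlinarith [hQle t ht]
  have hinv : ∀ t ∈ Set.Icc (0 : ℝ) (1 / 4),
      momentum (P (Q t / Real.sin t)) = Q t / Real.sin t := fun t ht =>
    hPinv _ (abs_le.1 ((hqle t ht).trans (by linarith [ht.2])))
  have hple : ∀ t, |P (Q t / Real.sin t)| ≤ 1 / 2 := fun t => abs_le.2 (hPmem _)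
  have hpsq : ∀ t, P (Q t / Real.sin t) ^ 2 ≤ 1 / 4 := fun t => by
    have := sq_le_sq' (hPmem (Q t / Real.sin t)).1 (hPmem (Q t / Real.sin t)).2
    linarith
  have hplin : ∀ t ∈ Set.Icc (0 : ℝ) (1 / 4), |P (Q t / Real.sin t)| ≤ 2 * t := by
    intro t ht
    have h1 := momentum_sub_self (P (Q t / Real.sin t))
    have h2 := hqle t ht
    have h3 := hpsq t
    rw [hinv t ht] at h1
    have h4 : P (Q t / Real.sin t) =
        Q t / Real.sin t * (1 + (2 * P (Q t / Real.sin t) ^ 2 + P (Q t / Real.sin t) ^ 4)) := by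
      linarith
    rw [h4, abs_mul, abs_of_nonneg (by positivity :
      0 ≤ 1 + (2 * P (Q t / Real.sin t) ^ 2 + P (Q t / Real.sin t) ^ 4))]
    calc _ ≤ 2 / 3 * t * 3 := by
          refine mul_le_mul h2 ?_ (by positivity) (by linarith [ht.1])
          nlinarith [sq_nonneg (P (Q t / Real.sin t))]
      _ = 2 * t := by ring
  refine ⟨fun t => P (Q t / Real.sin t), ?_, fun t _ => hple t, fun t ht => ?_, fun t ht => ?_⟩
  · simpa using hplin 0 (by norm_num)
  · have hQ2 := abs_flux_add_one_sub_cos_le hQ0 hQ hplin t ht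
    rcases ht.1.eq_or_lt' with rfl | h
    · simpa using hplin 0 (by norm_num)
    have ht1 : |t| ≤ 1 := by rw [abs_of_pos h]; linarith [ht.2]
    have hcos := Real.cos_bound ht1
    rw [abs_of_pos h] at hcos
    have hs := three_quarters_mul_le_sin ht
    have hs0 : 0 < Real.sin t := by linarith
    have hs1 := Real.sin_gt_sub_cube h
    have hs2 := Real.sin_lt h
    have hq : |Q t / Real.sin t + t / 2| ≤ 6 * t ^ 3 := by
      have e : Q t / Real.sin t + t / 2 = (Q t + t / 2 * Real.sin t) / Real.sin t := by
        field_simp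
      rw [e, abs_div, abs_of_pos hs0, div_le_iff₀ hs0]
      have hA : |Q t + t / 2 * Real.sin t| ≤ 9 / 2 * t ^ 4 := by
        rw [abs_le] at hQ2 hcos ⊢
        have h5 : t * (t - t ^ 3 / 6) ≤ t * Real.sin t := by gcongr
        have h6 : t * Real.sin t ≤ t * t := by gcongr
        have h7 : 0 ≤ t ^ 4 := by positivity
        constructor <;> linarith
      have hB : 6 * t ^ 3 * (3 / 4 * t) ≤ 6 * t ^ 3 * Real.sin t := by gcongr
      linarith
    have hpq : |P (Q t / Real.sin t) - Q t / Real.sin t| ≤ 8 * t ^ 3 := by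
      have h1 := momentum_sub_self (P (Q t / Real.sin t))
      rw [hinv t ht] at h1
      rw [h1, abs_mul, abs_of_nonneg (by positivity :
        0 ≤ 2 * P (Q t / Real.sin t) ^ 2 + P (Q t / Real.sin t) ^ 4)]
      have h2 := hplin t ht
      rw [abs_le] at h2
      have h3 := sq_le_sq' h2.1 h2.2
      calc _ ≤ 2 / 3 * t * (12 * t ^ 2) := by
            refine mul_le_mul (hqle t ht) ?_ (by positivity) (by linarith)
            nlinarith [sq_nonneg (P (Q t / Real.sin t)), hpsq t]
        _ = 8 * t ^ 3 := by ring
    rw [abs_le] at hq hpq ⊢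
    constructor <;> linarith
  · have ht' := Set.Ioo_subset_Icc_self ht
    have hs0 : 0 < Real.sin t := by linarith [three_quarters_mul_le_sin ht', ht.1]
    have hQd := (hQ t ht').hasDerivAt (Icc_mem_nhds ht.1 ht.2)
    have hqd := hQd.fun_div (Real.hasDerivAt_sin t) hs0.ne'
    have h3 : 0 < 1 - 3 * P (Q t / Real.sin t) ^ 2 := by linarith [hpsq t]
    have hqlt := abs_le.1 ((hqle t ht').trans (show 2 / 3 * t ≤ 1 / 6 by linarith [ht.2]))
    have hPd : HasDerivAt P _ (Q t / Real.sin t) :=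
      HasDerivAt.of_local_left_inverse hP.continuous.continuousAt (hasDerivAt_momentum _)
        (by positivity) (Filter.eventually_of_mem (Icc_mem_nhds
          (show -(8 / 25) < Q t / Real.sin t by linarith)
          (show Q t / Real.sin t < 8 / 25 by linarith)) hPinv)
    refine (hPd.comp t hqd).congr_deriv ?_
    change _ = slopeRate t (P (Q t / Real.sin t))
    have e := hinv t ht'
    rw [momentum, eq_div_iff hs0.ne'] at e
    generalize P (Q t / Real.sin t) = p at e h3 ⊢
    rw [← e, slopeRate, forcing]
    field_simp

lemma radial_equation_iff {t p r : ℝ} :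
    r + (Real.cos t / Real.sin t) * p * ((1 + p ^ 2) / (1 - 3 * p ^ 2)) =
      (1 + p ^ 2) * (p ^ 2 - 1) / (1 - 3 * p ^ 2) ↔ r = slopeRate t p := by
  rw [slopeRate, sub_div, eq_sub_iff_add_eq]
  simp only [mul_assoc, mul_div_assoc]

lemma Ico_mem_nhdsWithin_Ici {δ x : ℝ} (hx : x ∈ Set.Ico 0 δ) :
    Set.Ico 0 δ ∈ nhdsWithin x (Set.Ici x) :=
  mem_of_superset (Ico_mem_nhdsGE hx.2) (Set.Ico_subset_Ico_left hx.1)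

namespace IsRadialSol

variable {δ u₀ : ℝ} {u u' u'' v v' v'' : ℝ → ℝ}

lemma one_sub_three_mul_sq_pos (h : IsRadialSol δ u₀ u u' u'') {t : ℝ} (ht : t ∈ Set.Ico 0 δ) :
    0 < 1 - 3 * u' t ^ 2 := by
  obtain ⟨-, h2, -, -, h5, h6, -⟩ := h
  by_contra! hneg
  have hc : ContinuousOn (fun t => 1 - 3 * u' t ^ 2) (Set.Icc 0 t) := by
    have : ContinuousOn u' (Set.Icc 0 t) := fun s hs =>
      (h2 s ⟨hs.1, hs.2.trans_lt ht.2⟩).continuousWithinAt.mono fun x hx =>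
        ⟨hx.1, hx.2.trans_lt ht.2⟩
    fun_prop
  obtain ⟨s, hs, hs0⟩ := intermediate_value_Icc' ht.1 hc
    (show (0 : ℝ) ∈ Set.Icc _ _ from ⟨hneg, by simp [h5]⟩)
  exact h6 s ⟨hs.1, hs.2.trans_lt ht.2⟩ hs0

lemma exists_slope_bound (h : IsRadialSol δ u₀ u u' u'') {b : ℝ} (hb : b ∈ Set.Ico 0 δ) :
    ∃ m, 3 * m ^ 2 < 1 ∧ ∀ t ∈ Set.Icc 0 b, |u' t| ≤ m := by
  have hsub : Set.Icc 0 b ⊆ Set.Ico 0 δ := fun x hx => ⟨hx.1, hx.2.trans_lt hb.2⟩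
  have hc : ContinuousOn (fun t => |u' t|) (Set.Icc 0 b) := fun s hs =>
    ((h.2.1 s (hsub hs)).continuousWithinAt.mono hsub).abs
  obtain ⟨s, hs, hmax⟩ := isCompact_Icc.exists_isMaxOn (Set.nonempty_Icc.2 hb.1) hc
  refine ⟨|u' s|, ?_, hmax⟩
  rw [sq_abs]
  linarith [h.one_sub_three_mul_sq_pos (hsub hs)]

/-- The equation in divergence form `(sin θ · momentum u')' = sin θ · forcing u'`. -/
lemma hasDerivWithinAt_flux (h : IsRadialSol δ u₀ u u' u'') (hδ : δ ≤ Real.pi) {t : ℝ}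
    (ht : t ∈ Set.Ico 0 δ) :
    HasDerivWithinAt (fun t => Real.sin t * momentum (u' t)) (Real.sin t * forcing (u' t))
      (Set.Ico 0 δ) t := by
  have hd := (Real.hasDerivAt_sin t).hasDerivWithinAt.fun_mul
    ((hasDerivAt_momentum (u' t)).comp_hasDerivWithinAt t (h.2.1 t ht))
  refine hd.congr_deriv ?_
  have hp := h.one_sub_three_mul_sq_pos ht
  obtain ⟨-, -, -, -, h5, -, h7⟩ := h
  rcases ht.1.eq_or_lt' with rfl | h0
  · simp [h5]
  have hs : Real.sin t ≠ 0 := (Real.sin_pos_of_pos_of_lt_pi h0 (ht.2.trans_le hδ)).ne'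
  rw [radial_equation_iff.1 (h7 t ⟨h0, ht.2⟩), slopeRate, forcing, Function.comp_apply,
    momentum, div_mul_div_comm, mul_comm ((1 + u' t ^ 2) ^ 3), mul_div_mul_left _ _ hp.ne']
  field_simp
  ring

lemma slope_eqOn (hu : IsRadialSol δ u₀ u u' u'') (hv : IsRadialSol δ u₀ v v' v'')
    (hδ : δ ≤ Real.pi) : Set.EqOn v' u' (Set.Ico 0 δ) := by
  intro b hb
  rcases hb.1.eq_or_lt' with rfl | h0
  · rw [hu.2.2.2.2.1, hv.2.2.2.2.1]
  have hsub : Set.Icc 0 b ⊆ Set.Ico 0 δ := fun x hx => ⟨hx.1, hx.2.trans_lt hb.2⟩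
  obtain ⟨m₁, hm₁, hb₁⟩ := hu.exists_slope_bound hb
  obtain ⟨m₂, hm₂, hb₂⟩ := hv.exists_slope_bound hb
  have hm : 3 * (max m₁ m₂) ^ 2 < 1 := by
    rcases max_choice m₁ m₂ with h | h <;> rwa [h]
  obtain ⟨c, hc, hexp⟩ := exists_pos_mul_abs_sub_le_abs_momentum_sub hm
  have hexp' : ∀ t ∈ Set.Icc 0 b,
      c * |v' t - u' t| ≤ |momentum (v' t) - momentum (u' t)| := fun t ht =>
    hexp _ (abs_le.1 ((hb₂ t ht).trans (le_max_right _ _)))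
      _ (abs_le.1 ((hb₁ t ht).trans (le_max_left _ _)))
  have hd : ∀ t ∈ Set.Ico 0 δ, HasDerivWithinAt
      (fun t => Real.sin t * momentum (v' t) - Real.sin t * momentum (u' t))
      (Real.sin t * forcing (v' t) - Real.sin t * forcing (u' t)) (Set.Ico 0 δ) t := fun t ht =>
    (hv.hasDerivWithinAt_flux hδ ht).fun_sub (hu.hasDerivWithinAt_flux hδ ht)
  have hgron := norm_le_gronwallBound_of_norm_deriv_right_le (K := 6 / c) (ε := 0) (δ := 0)
    (fun t ht => (hd t (hsub ht)).continuousWithinAt.mono hsub)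
    (fun t ht => (hd t (hsub (Set.Ico_subset_Icc_self ht))).mono_of_mem_nhdsWithin
      (Ico_mem_nhdsWithin_Ici (hsub (Set.Ico_subset_Icc_self ht)))) (by simp)
    (fun t ht => by
      have ht' := Set.Ico_subset_Icc_self ht
      have h1 := hexp' t ht'
      rw [← mul_sub, ← mul_sub, norm_mul, norm_mul, Real.norm_eq_abs, Real.norm_eq_abs,
        Real.norm_eq_abs, add_zero]
      calc |Real.sin t| * |forcing (v' t) - forcing (u' t)|
          ≤ |Real.sin t| * (6 * (|momentum (v' t) - momentum (u' t)| / c)) := by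
            gcongr
            refine (abs_forcing_sub_le _ _).trans ?_
            gcongr
            rwa [le_div_iff₀' hc]
        _ = 6 / c * (|Real.sin t| * |momentum (v' t) - momentum (u' t)|) := by ring)
    b (Set.right_mem_Icc.2 hb.1)
  have hs : Real.sin b ≠ 0 := (Real.sin_pos_of_pos_of_lt_pi h0 (hb.2.trans_le hδ)).ne'
  rw [gronwallBound_ε0_δ0, ← mul_sub] at hgron
  have hz : momentum (v' b) - momentum (u' b) = 0 :=
    (mul_eq_zero.1 (norm_le_zero_iff.1 hgron)).resolve_left hs
  have h1 := hexp' b (Set.right_mem_Icc.2 hb.1)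
  rw [hz, abs_zero] at h1
  have h2 : |v' b - u' b| ≤ 0 := by
    by_contra! hpos
    exact absurd h1 (not_le.2 (mul_pos hc hpos))
  exact sub_eq_zero.1 (abs_nonpos_iff.1 h2)

lemma eqOn (hu : IsRadialSol δ u₀ u u' u'') (hv : IsRadialSol δ u₀ v v' v'')
    (hδ : δ ≤ Real.pi) : Set.EqOn v u (Set.Ico 0 δ) := by
  intro b hb
  have hsub : Set.Icc 0 b ⊆ Set.Ico 0 δ := fun x hx => ⟨hx.1, hx.2.trans_lt hb.2⟩
  have hd : ∀ t ∈ Set.Ico 0 δ, HasDerivWithinAt (fun t => v t - u t) 0 (Set.Ico 0 δ) t :=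
    fun t ht => ((hv.1 t ht).fun_sub (hu.1 t ht)).congr_deriv
      (sub_eq_zero.2 (slope_eqOn hu hv hδ ht))
  have h := constant_of_has_deriv_right_zero
    (fun t ht => (hd t (hsub ht)).continuousWithinAt.mono hsub)
    (fun t ht => (hd t (hsub (Set.Ico_subset_Icc_self ht))).mono_of_mem_nhdsWithin
      (Ico_mem_nhdsWithin_Ici (hsub (Set.Ico_subset_Icc_self ht)))) b (Set.right_mem_Icc.2 hb.1)
  simp only [hu.2.2.2.1, hv.2.2.2.1, sub_self] at h
  exact sub_eq_zero.1 h

lemma mono (h : IsRadialSol δ u₀ u u' u'') {ε : ℝ} (hε : ε ≤ δ) : IsRadialSol ε u₀ u u' u'' := by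
  have hsub : Set.Ico 0 ε ⊆ Set.Ico 0 δ := Set.Ico_subset_Ico_right hε
  obtain ⟨h1, h2, h3, h4, h5, h6, h7⟩ := h
  exact ⟨fun t ht => (h1 t (hsub ht)).mono hsub, fun t ht => (h2 t (hsub ht)).mono hsub,
    h3.mono hsub, h4, h5, fun t ht => h6 t (hsub ht),
    fun t ht => h7 t (Set.Ioo_subset_Ioo_right hε ht)⟩

end IsRadialSol

lemma tendsto_div_self_of_abs_add_half_le {p : ℝ → ℝ}
    (hp : ∀ t ∈ Set.Icc (0 : ℝ) (1 / 4), |p t + t / 2| ≤ 14 * t ^ 3) :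
    Tendsto (fun t => p t / t) (nhdsWithin 0 (Set.Ioi 0)) (nhds (-(1 / 2))) := by
  rw [← tendsto_sub_nhds_zero_iff]
  have h0 : Tendsto (fun t : ℝ => 14 * t ^ 2) (nhdsWithin 0 (Set.Ioi 0)) (nhds 0) := by
    have : Continuous fun t : ℝ => 14 * t ^ 2 := by fun_prop
    simpa using (this.tendsto 0).mono_left nhdsWithin_le_nhds
  refine squeeze_zero_norm' ?_ h0
  filter_upwards [Ioo_mem_nhdsGT (show (0 : ℝ) < 1 / 4 by norm_num)] with t ht
  have ht0 := ht.1
  rw [show p t / t - -(1 / 2) = (p t + t / 2) / t by field_simp; ring, Real.norm_eq_abs, abs_div,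
    abs_of_pos ht0, div_le_iff₀ ht0]
  calc _ ≤ _ := hp t (Set.Ioo_subset_Icc_self ht)
    _ = _ := by ring

lemma tendsto_slopeRate {p : ℝ → ℝ}
    (hp : Tendsto (fun t => p t / t) (nhdsWithin 0 (Set.Ioi 0)) (nhds (-(1 / 2)))) :
    Tendsto (fun t => slopeRate t (p t)) (nhdsWithin 0 (Set.Ioi 0)) (nhds (-(1 / 2))) := by
  have hid : Tendsto (fun t : ℝ => t) (nhdsWithin 0 (Set.Ioi 0)) (nhds 0) :=
    tendsto_id.mono_left nhdsWithin_le_nhds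
  have hp0 : Tendsto p (nhdsWithin 0 (Set.Ioi 0)) (nhds 0) := by
    have h := hp.mul hid
    rw [mul_zero] at h
    refine h.congr' ?_
    filter_upwards [self_mem_nhdsWithin] with t ht
    exact div_mul_cancel₀ _ (ne_of_gt ht)
  have hsinc : Tendsto Real.sinc (nhdsWithin 0 (Set.Ioi 0)) (nhds 1) := by
    simpa using (Real.continuous_sinc.tendsto 0).mono_left nhdsWithin_le_nhds
  have hcos : Tendsto Real.cos (nhdsWithin 0 (Set.Ioi 0)) (nhds 1) := by
    simpa using (Real.continuous_cos.tendsto 0).mono_left nhdsWithin_le_nhds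
  have hcot : Tendsto (fun t => Real.cos t / Real.sin t * p t) (nhdsWithin 0 (Set.Ioi 0))
      (nhds (-(1 / 2))) := by
    have h := (hcos.div hsinc one_ne_zero).mul hp
    rw [div_one, one_mul] at h
    refine h.congr' ?_
    filter_upwards [self_mem_nhdsWithin] with t ht
    have ht0 : t ≠ 0 := ne_of_gt ht
    simp only [Pi.div_apply]
    rw [Real.sinc_of_ne_zero ht0]
    field_simp
  have hsq : Tendsto (fun t => p t ^ 2) (nhdsWithin 0 (Set.Ioi 0)) (nhds 0) := by
    simpa using hp0.pow 2
  have h := (((hsq.const_add 1).mul (hsq.sub_const 1)).sub (hcot.mul (hsq.const_add 1))).div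
    ((hsq.const_mul 3).const_sub 1) (by norm_num)
  convert h using 1
  · funext t
    simp [slopeRate, mul_assoc]
  · norm_num

lemma exists_isRadialSol (u₀ : ℝ) : ∃ u u' u'' : ℝ → ℝ, IsRadialSol (1 / 8) u₀ u u' u'' ∧
    u'' 0 = -(1 / 2) ∧
    ∀ t ∈ Set.Icc (0 : ℝ) (1 / 8), |u t - (u₀ - t ^ 2 / 4)| ≤ 7 / 2 * t ^ 4 := by
  obtain ⟨p, hp0, hple, hpasymp, hpd⟩ := exists_slope
  have hlim := tendsto_div_self_of_abs_add_half_le hpasymp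
  have hIcc : Set.Icc (0 : ℝ) (1 / 8) ⊆ Set.Icc 0 (1 / 4) :=
    Set.Icc_subset_Icc_right (by norm_num)
  have hpos : ∀ t ∈ Set.Icc (0 : ℝ) (1 / 4), 0 < 1 - 3 * p t ^ 2 := fun t ht => by
    have h := abs_le.1 (hple t ht)
    linarith [sq_le_sq' h.1 h.2]
  have hd : ∀ t ∈ Set.Ico (0 : ℝ) (1 / 4), HasDerivWithinAt p
      (Function.update (fun t => slopeRate t (p t)) 0 (-(1 / 2)) t) (Set.Ici 0) t := by
    intro t ht
    rcases ht.1.eq_or_lt' with rfl | h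
    · rw [Function.update_self, hasDerivWithinAt_iff_tendsto_slope, Set.Ici_sdiff_left]
      refine hlim.congr fun t => ?_
      rw [slope_def_field, hp0, sub_zero, sub_zero]
    · rw [Function.update_of_ne h.ne']
      exact (hpd t ⟨h, ht.2⟩).hasDerivWithinAt
  have hpc : ContinuousOn p (Set.Icc 0 (1 / 8)) := fun t ht =>
    (hd t ⟨ht.1, by linarith [ht.2]⟩).continuousWithinAt.mono Set.Icc_subset_Ici_self
  have hle : (0 : ℝ) ≤ 1 / 8 := by norm_num
  have hext : Continuous (Set.IccExtend hle ((Set.Icc 0 (1 / 8)).domRestrict p)) :=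
    hpc.domRestrict.Icc_extend'
  have hud : ∀ t ∈ Set.Icc (0 : ℝ) (1 / 8), HasDerivAt
      (fun t => u₀ + ∫ s in (0 : ℝ)..t, Set.IccExtend hle ((Set.Icc 0 (1 / 8)).domRestrict p) s)
      (p t) t := fun t ht => by
    refine ((hext.integral_hasStrictDerivAt 0 t).hasDerivAt.const_add u₀).congr_deriv ?_
    rw [Set.IccExtend_of_mem hle _ ht, Set.domRestrict_apply]
  refine ⟨_, p, _, ⟨fun t ht => (hud t (Set.Ico_subset_Icc_self ht)).hasDerivWithinAt,
    fun t ht => (hd t ⟨ht.1, by linarith [ht.2]⟩).mono Set.Ico_subset_Ici_self, ?_, by simp, hp0,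
    fun t ht => (hpos t (hIcc (Set.Ico_subset_Icc_self ht))).ne', fun t ht => ?_⟩,
    Function.update_self .., ?_⟩
  · intro t ht
    rcases ht.1.eq_or_lt' with rfl | h
    · rw [continuousWithinAt_update_same]
      exact (tendsto_slopeRate hlim).mono_left
        (nhdsWithin_mono _ fun x hx => lt_of_le_of_ne hx.1.1 (Ne.symm hx.2))
    · have hs : Real.sin t ≠ 0 :=
        (Real.sin_pos_of_pos_of_lt_pi h (by linarith [ht.2, Real.pi_gt_three])).ne'
      have hpt := (hpd t ⟨h, by linarith [ht.2]⟩).continuousAt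
      have h3 := (hpos t (hIcc (Set.Ico_subset_Icc_self ht))).ne'
      refine ((continuousAt_update_of_ne h.ne').2 ?_).continuousWithinAt
      unfold slopeRate
      fun_prop (disch := assumption)
  · rw [radial_equation_iff, Function.update_of_ne ht.1.ne']
  · have hd2 : ∀ t ∈ Set.Icc (0 : ℝ) (1 / 8), HasDerivAt
        (fun t => u₀ + (∫ s in (0 : ℝ)..t, Set.IccExtend hle ((Set.Icc 0 (1 / 8)).domRestrict p) s)
          - (u₀ - t ^ 2 / 4)) (p t + t / 2) t := fun t ht =>
      ((hud t ht).fun_sub (((hasDerivAt_pow 2 t).div_const 4).const_sub u₀)).congr_deriv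
        (by norm_num; ring)
    exact image_norm_le_of_norm_deriv_right_le_deriv_boundary
      (fun t ht => (hd2 t ht).continuousAt.continuousWithinAt)
      (fun t ht => (hd2 t (Set.Ico_subset_Icc_self ht)).hasDerivWithinAt)
      (B := fun t => 7 / 2 * t ^ 4) (B' := fun t => 14 * t ^ 3) (by simp)
      (fun t => ((hasDerivAt_pow 4 t).const_mul (7 / 2)).congr_deriv (by norm_num; ring))
      fun t ht => hpasymp t (hIcc (Set.Ico_subset_Icc_self ht))

/-- For every initial height `u₀` there exist `δ > 0` and a unique twice continuously
differentiable solution `u` on `[0,δ)` of the rotationally symmetric Euler–Lagrange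
equation of the incompressible source flow model with `u(0) = u₀`, `u'(0) = 0`.
Moreover `u''(0) = −1/2`, `u` is strictly concave on `[0,δ)`, and
`u(θ) = u₀ − θ²/4 + O(θ⁴)` as `θ → 0⁺`. -/
theorem stmt_17 (u₀ : ℝ) :
    ∃ δ > 0, ∃ u u' u'' : ℝ → ℝ,
      IsRadialSol δ u₀ u u' u'' ∧
      (∀ v v' v'' : ℝ → ℝ, IsRadialSol δ u₀ v v' v'' → Set.EqOn v u (Set.Ico 0 δ)) ∧
      u'' 0 = -(1 / 2) ∧
      (∀ θ ∈ Set.Ico 0 δ, u'' θ < 0) ∧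
      (fun θ => u θ - (u₀ - θ ^ 2 / 4)) =O[nhdsWithin 0 (Set.Ioi 0)] fun θ => θ ^ 4 := by
  obtain ⟨u, u', u'', hu, hu0, hexp⟩ := exists_isRadialSol u₀
  have hneg : ∀ᶠ t in nhdsWithin 0 (Set.Ici 0), u'' t < 0 := by
    have hc := hu.2.2.1 0 (by norm_num)
    rw [ContinuousWithinAt, nhdsWithin_Ico_eq_nhdsGE (by norm_num)] at hc
    exact hc.eventually_lt_const (by rw [hu0]; norm_num)
  obtain ⟨ε, hε, hεneg⟩ := mem_nhdsGE_iff_exists_Ico_subset.1 hneg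
  have hε8 : min ε (1 / 8) ≤ 1 / 8 := min_le_right _ _
  refine ⟨min ε (1 / 8), lt_min hε (by norm_num), u, u', u'', hu.mono hε8, fun v v' v'' hv =>
    (hu.mono hε8).eqOn hv (by linarith [Real.pi_gt_three]), hu0,
    fun t ht => hεneg ⟨ht.1, ht.2.trans_le (min_le_left _ _)⟩, ?_⟩
  refine IsBigO.of_bound (7 / 2) ?_
  filter_upwards [Ioo_mem_nhdsGT (show (0 : ℝ) < 1 / 8 by norm_num)] with t ht
  rw [Real.norm_eq_abs, Real.norm_eq_abs, abs_of_nonneg (by positivity : 0 ≤ t ^ 4)]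
  exact hexp t (Set.Ioo_subset_Icc_self ht)
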